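/- Let Θ ⊆ ℝᵐ and Φ ⊆ ℝⁿ be nonempty compact convex sets, and let ℓ_D : Θ × Φ^k → ℝ and ℓ_i : Θ × Φ^k → ℝ (for i = 1,…,k) be continuously differentiable. Then there exists a point (θ*, φ*) ∈ Θ × Φ^k such that for all θ ∈ Θ, ⟨∇_θ ℓ_D(θ*, φ*), θ − θ*⟩ ≤ 0, and for each i and all φ_i ∈ Φ, ⟨∇_{φ_i} ℓ_i(θ*, φ*), φ_i − φ*_i⟩ ≤ 0. (Existence of a first-order Stackelberg/Nash equilibrium point.) -/

import Mathlib

open scoped RealInnerProductSpace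
open MeasureTheory Metric

namespace FOSE

lemma lagrange_extrap (N : ℕ) (ε : ℝ) (hε : 0 < ε) :
    ∃ (t w : ℕ → ℝ), (∀ j, 0 < t j ∧ t j < ε) ∧ ∀ p : Polynomial ℝ, p.natDegree ≤ N →
      p.eval 1 = ∑ j ∈ Finset.range (N+1), w j * p.eval (t j) := by
  let t : ℕ → ℝ := fun j => ε / (j + 2)
  have hinj : Set.InjOn t (Finset.range (N+1) : Finset ℕ) := by
    intro a _ b _ hab
    simp only [t] at hab
    have ha : (0:ℝ) < a + 2 := by positivity
    have hb : (0:ℝ) < b + 2 := by positivity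
    rw [div_eq_div_iff ha.ne' hb.ne'] at hab
    have := mul_left_cancel₀ hε.ne' hab
    have h2 : (a:ℝ) = b := by linarith
    exact_mod_cast h2
  refine ⟨t, fun j => (Lagrange.basis (Finset.range (N+1)) t j).eval 1, ?_, ?_⟩
  · intro j
    refine ⟨by simp only [t]; positivity, ?_⟩
    simp only [t]
    have hj : (0:ℝ) ≤ j := by positivity
    rw [div_lt_iff₀ (by positivity)]
    nlinarith
  · intro p hp
    have hdeg : p.degree < (Finset.range (N+1)).card := by
      rw [Finset.card_range]
      refine lt_of_le_of_lt Polynomial.degree_le_natDegree ?_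
      exact_mod_cast Nat.lt_succ_of_le hp
    conv_lhs => rw [Lagrange.eq_interpolate hinj hdeg]
    rw [Lagrange.interpolate_apply, Polynomial.eval_finsetSum]
    refine Finset.sum_congr rfl fun j _ => ?_
    simp [mul_comm]

section
variable {E : Type*} [NormedAddCommGroup E] [InnerProductSpace ℝ E] [FiniteDimensional ℝ E]

lemma integrand_poly (q : Polynomial ℝ) (x v : E) (A : E →L[ℝ] E) :
    ∃ p : Polynomial ℝ, p.natDegree ≤ q.natDegree * 2 + Module.finrank ℝ E ∧
      ∀ t : ℝ, p.eval t = q.eval (‖x - t • v‖^2) *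
        (ContinuousLinearMap.id ℝ E - t • A).det := by
  let bs := Module.finBasis ℝ E
  let M := LinearMap.toMatrix bs bs (A : E →ₗ[ℝ] E)
  let r : Polynomial ℝ := Polynomial.C (‖v‖^2) * Polynomial.X^2 +
    Polynomial.C (-2 * ⟪x, v⟫) * Polynomial.X + Polynomial.C (‖x‖^2)
  let d : Polynomial ℝ := ((Polynomial.X : Polynomial ℝ) • (-M).map (Polynomial.C : ℝ →+* Polynomial ℝ)
    + (1 : Matrix (Fin (Module.finrank ℝ E)) (Fin (Module.finrank ℝ E)) ℝ).map (Polynomial.C : ℝ →+* Polynomial ℝ)).det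
  refine ⟨q.comp r * d, ?_, ?_⟩
  · refine Polynomial.natDegree_mul_le.trans (add_le_add ?_ ?_)
    · refine Polynomial.natDegree_comp_le.trans (Nat.mul_le_mul_left _ ?_)
      exact Polynomial.natDegree_quadratic_le
    · refine (Polynomial.natDegree_det_X_add_C_le _ _).trans ?_
      simp
  · intro t
    rw [Polynomial.eval_mul, Polynomial.eval_comp]
    congr 1
    · congr 1
      simp only [r, Polynomial.eval_add, Polynomial.eval_mul, Polynomial.eval_C,
        Polynomial.eval_pow, Polynomial.eval_X]
      rw [norm_sub_sq_real, inner_smul_right, norm_smul, mul_pow, Real.norm_eq_abs, sq_abs]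
      ring
    · rw [ContinuousLinearMap.det, ← LinearMap.det_toMatrix bs]
      simp only [d]
      rw [← Polynomial.coe_evalRingHom, RingHom.map_det]
      congr 1
      ext i j
      simp [M, LinearMap.toMatrix_apply, Matrix.one_apply, Finsupp.single_apply, eq_comm]
      split_ifs <;> simp <;> ring

variable [MeasurableSpace E] [BorelSpace E]

lemma small_t (b : E → E) (hb : ContDiff ℝ 1 b) (R : ℝ) (hR : ∀ x, R ≤ ‖x‖ → b x = 0) :
    ∃ ε > 0, ∀ t : ℝ, 0 < t → t < ε → ∀ q : Polynomial ℝ,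
      ∫ x in ball (0:E) R, q.eval (‖x - t • b x‖^2) *
        (ContinuousLinearMap.id ℝ E - t • fderiv ℝ b x).det
      = ∫ x in ball (0:E) R, q.eval (‖x‖^2) := by
  have hc : HasCompactSupport b := by
    refine HasCompactSupport.intro (isCompact_closedBall (0:E) R) fun x hx => hR x ?_
    simp at hx
    exact hx.le
  obtain ⟨L, hL⟩ := hb.lipschitzWith_of_hasCompactSupport hc one_ne_zero
  have hdet : ∀ᶠ A : E →L[ℝ] E in nhds (ContinuousLinearMap.id ℝ E), 0 < A.det := by
    refine ContinuousLinearMap.continuous_det.continuousAt.eventually (lt_mem_nhds ?_)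
    simp [ContinuousLinearMap.det]
  obtain ⟨δ, hδ, hδ'⟩ := Metric.eventually_nhds_iff.1 hdet
  have hLn : ∀ x, ‖fderiv ℝ b x‖ ≤ L := fun x => norm_fderiv_le_of_lipschitz ℝ hL
  refine ⟨min (1 / (L + 1)) (δ / (L + 1)), by positivity, ?_⟩
  intro t ht0 ht q
  have hL0 : (0:ℝ) ≤ L := L.2
  have ht1 : t * (L + 1) < 1 := (lt_div_iff₀ (by positivity)).1 (ht.trans_le (min_le_left _ _))
  have ht2 : t * (L + 1) < δ := (lt_div_iff₀ (by positivity)).1 (ht.trans_le (min_le_right _ _))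
  have hpos : ∀ x, 0 < (ContinuousLinearMap.id ℝ E - t • fderiv ℝ b x).det := by
    intro x
    apply hδ'
    rw [dist_eq_norm, sub_sub_cancel_left, norm_neg, norm_smul, Real.norm_of_nonneg ht0.le]
    nlinarith [hLn x]
  have hinj : Function.Injective (fun x => x - t • b x) := by
    intro x y hxy
    simp only at hxy
    have h1 : x - y = t • (b x - b y) := by
      rw [smul_sub]
      have := sub_eq_zero.2 hxy
      rw [← sub_eq_zero]
      rw [← this]; abel
    have h2 : ‖x - y‖ ≤ t * (L * ‖x - y‖) := by
      conv_lhs => rw [h1]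
      rw [norm_smul, Real.norm_of_nonneg ht0.le]
      have := hL.dist_le_mul x y
      rw [dist_eq_norm, dist_eq_norm] at this
      gcongr
    have h3 : ‖x - y‖ ≤ 0 := by
      by_contra h
      push Not at h
      nlinarith
    exact sub_eq_zero.1 (norm_le_zero_iff.1 h3)
  have hsurj : Function.Surjective (fun x => x - t • b x) := by
    intro y
    have hcon : ContractingWith (⟨t, ht0.le⟩ * L) (fun x => y + t • b x) := by
      refine ⟨?_, ?_⟩
      · rw [← NNReal.coe_lt_coe]
        change t * (L:ℝ) < 1
        nlinarith
      · refine LipschitzWith.of_dist_le_mul fun x z => ?_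
        rw [dist_add_left, dist_eq_norm, ← smul_sub, norm_smul, Real.norm_of_nonneg ht0.le]
        have := hL.dist_le_mul x z
        rw [dist_eq_norm] at this
        push_cast
        change _ ≤ t * (L:ℝ) * _
        rw [mul_assoc]
        gcongr
    refine ⟨hcon.fixedPoint, ?_⟩
    have := hcon.fixedPoint_isFixedPt
    rw [Function.IsFixedPt] at this
    simp only
    nth_rw 1 [← this]
    simp
  have himg : (fun x => x - t • b x) '' ball (0:E) R = ball (0:E) R := by
    apply Set.Subset.antisymm
    · rintro _ ⟨x, hx, rfl⟩
      by_contra h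
      have h' : b (x - t • b x) = 0 := hR _ (by simpa using h)
      have : (x - t • b x) = x := by
        apply hinj
        simp [h']
      simp only [this] at h
      exact h hx
    · intro y hy
      obtain ⟨x, rfl⟩ := hsurj y
      refine ⟨x, ?_, rfl⟩
      by_contra h
      have h' : b x = 0 := hR _ (by simpa using h)
      simp [h'] at hy
      simp at h
      linarith
  have key := integral_image_eq_integral_abs_det_fderiv_smul (volume : Measure E)
    (s := ball (0:E) R) (f := fun x => x - t • b x)
    (f' := fun x => ContinuousLinearMap.id ℝ E - t • fderiv ℝ b x) measurableSet_ball
    (fun x _ => ((hasFDerivAt_id x).sub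
      (((hb.differentiable one_ne_zero) x).hasFDerivAt.const_smul t)).hasFDerivWithinAt)
    hinj.injOn (fun y => q.eval (‖y‖^2))
  rw [himg] at key
  rw [key]
  refine integral_congr_ae (Filter.Eventually.of_forall fun x => ?_)
  simp only [smul_eq_mul]
  rw [abs_of_pos (hpos x), mul_comm]

lemma integrable_aux (b : E → E) (hb : ContDiff ℝ 1 b) (R t : ℝ) (g : ℝ → ℝ) (hg : Continuous g) :
    IntegrableOn (fun x => g (‖x - t • b x‖^2) *
        (ContinuousLinearMap.id ℝ E - t • fderiv ℝ b x).det) (ball (0:E) R) := by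
  have hf := hb.continuous_fderiv one_ne_zero
  have hbc := hb.continuous
  have : Continuous (fun x => g (‖x - t • b x‖^2) *
        (ContinuousLinearMap.id ℝ E - t • fderiv ℝ b x).det) := by
    refine Continuous.mul (by fun_prop) ?_
    exact ContinuousLinearMap.continuous_det.comp (by fun_prop)
  exact (this.continuousOn.integrableOn_compact (isCompact_closedBall (0:E) R)).mono_set
    ball_subset_closedBall

lemma poly_identity (b : E → E) (hb : ContDiff ℝ 1 b) (R : ℝ) (hR : ∀ x, R ≤ ‖x‖ → b x = 0)
    (q : Polynomial ℝ) :
      ∫ x in ball (0:E) R, q.eval (‖x - b x‖^2) *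
        (ContinuousLinearMap.id ℝ E - fderiv ℝ b x).det
      = ∫ x in ball (0:E) R, q.eval (‖x‖^2) := by
  obtain ⟨ε, hε, h⟩ := small_t b hb R hR
  obtain ⟨t, w, ht, hw⟩ := lagrange_extrap (q.natDegree * 2 + Module.finrank ℝ E) ε hε
  have h1 : ∀ x, q.eval (‖x - b x‖^2) * (ContinuousLinearMap.id ℝ E - fderiv ℝ b x).det =
      ∑ j ∈ Finset.range (q.natDegree * 2 + Module.finrank ℝ E + 1), w j *
        (q.eval (‖x - t j • b x‖^2) *
        (ContinuousLinearMap.id ℝ E - t j • fderiv ℝ b x).det) := by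
    intro x
    obtain ⟨p, hp, hpe⟩ := integrand_poly q x (b x) (fderiv ℝ b x)
    have := hw p hp
    simp only [hpe, one_smul] at this
    exact this
  simp only [h1]
  rw [integral_finsetSum _ fun j _ => (integrable_aux b hb R (t j) (fun s => q.eval s)
    q.continuous).const_mul _]
  simp only [integral_const_mul, h _ (ht _).1 (ht _).2]
  rw [← Finset.sum_mul]
  have := hw 1 (by simp)
  simp only [Polynomial.eval_one, mul_one] at this
  rw [← this, one_mul]

lemma exists_fixed_smooth (b : E → E) (hb : ContDiff ℝ 1 b) (R : ℝ) (hR0 : 0 < R)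
    (hR : ∀ x, R ≤ ‖x‖ → b x = 0) : ∃ x ∈ closedBall (0:E) R, b x = x := by
  by_contra! hne
  have hbc := hb.continuous
  have hK := isCompact_closedBall (0:E) R
  have hKne : (closedBall (0:E) R).Nonempty := ⟨0, by simp [hR0.le]⟩
  obtain ⟨x0, hx0, hmin⟩ := hK.exists_isMinOn hKne
    (f := fun x => ‖x - b x‖^2) (by fun_prop)
  obtain ⟨x1, hx1, hmax⟩ := hK.exists_isMaxOn hKne
    (f := fun x => ‖x - b x‖^2) (by fun_prop)
  set δ := ‖x0 - b x0‖^2 with hδ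
  have hδ0 : 0 < δ := by
    have : x0 - b x0 ≠ 0 := sub_ne_zero.2 (hne x0 hx0).symm
    positivity
  set M := max (‖x1 - b x1‖^2) (R^2)
  have hM1 : ∀ x ∈ ball (0:E) R, ‖x - b x‖^2 ≤ M := fun x hx =>
    le_trans (hmax (ball_subset_closedBall hx)) (le_max_left _ _)
  have hM2 : ∀ x ∈ ball (0:E) R, ‖x‖^2 ≤ M := fun x hx => by
    refine le_trans ?_ (le_max_right _ _)
    simp at hx
    gcongr
  have hδ1 : ∀ x ∈ ball (0:E) R, δ ≤ ‖x - b x‖^2 := fun x hx => hmin (ball_subset_closedBall hx)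
  let β : ℝ → ℝ := fun s => max 0 (δ - s)
  have hβ : Continuous β := by fun_prop
  set C := ∫ x in ball (0:E) R, |(ContinuousLinearMap.id ℝ E - fderiv ℝ b x).det| with hC
  have hdi : IntegrableOn (fun x => (ContinuousLinearMap.id ℝ E - fderiv ℝ b x).det)
      (ball (0:E) R) := by
    simpa using integrable_aux b hb R 1 (fun _ => 1) (by fun_prop)
  have hci : ∀ g : ℝ → ℝ, Continuous g → IntegrableOn (fun x : E => g (‖x‖^2)) (ball (0:E) R) :=
    fun g hg => (Continuous.continuousOn (by fun_prop)).integrableOn_compact hK |>.mono_set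
      ball_subset_closedBall
  set V := (volume : Measure E).real (ball (0:E) R)
  have hC0 : 0 ≤ C := integral_nonneg fun x => abs_nonneg _
  have hV0 : 0 ≤ V := measureReal_nonneg
  have hcε : ∀ ε : ℝ, IntegrableOn (fun _ : E => ε) (ball (0:E) R) := fun ε =>
    hci (fun _ => ε) continuous_const
  have main : ∀ ε > 0, ∫ x in ball (0:E) R, β (‖x‖^2) ≤ ε * (C + V) := by
    intro ε hε
    obtain ⟨q, hq⟩ := exists_polynomial_near_of_continuousOn 0 M β hβ.continuousOn ε hε
    have e := poly_identity b hb R hR q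
    have l1 : ∫ x in ball (0:E) R, q.eval (‖x - b x‖^2) *
        (ContinuousLinearMap.id ℝ E - fderiv ℝ b x).det ≤ ε * C := by
      rw [hC, ← integral_const_mul]
      refine setIntegral_mono_on ?_ (hdi.abs.const_mul ε) measurableSet_ball ?_
      · simpa using integrable_aux b hb R 1 (fun s => q.eval s) q.continuous
      · intro x hx
        have h1 := hq (‖x - b x‖^2) ⟨by positivity, hM1 x hx⟩
        have h2 : β (‖x - b x‖^2) = 0 := max_eq_left (by linarith [hδ1 x hx])
        rw [h2, sub_zero] at h1
        refine (le_abs_self _).trans ?_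
        rw [abs_mul]
        gcongr
    have l2 : (∫ x in ball (0:E) R, β (‖x‖^2)) - ε * V ≤ ∫ x in ball (0:E) R, q.eval (‖x‖^2) := by
      have : ε * V = ∫ x in ball (0:E) R, ε := by simp [V, mul_comm]
      rw [this, ← integral_sub (hci β hβ) (hcε ε)]
      refine setIntegral_mono_on ((hci β hβ).sub (hcε ε))
        (hci (fun s => q.eval s) q.continuous) measurableSet_ball ?_
      intro x hx
      have h1 := hq (‖x‖^2) ⟨by positivity, hM2 x hx⟩
      have := (abs_lt.1 h1).1
      linarith
    linarith
  have hI0 : ∫ x in ball (0:E) R, β (‖x‖^2) ≤ 0 := by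
    refine le_of_forall_pos_le_add fun η hη => ?_
    have := main (η / (C + V + 1)) (by positivity)
    refine this.trans ?_
    rw [zero_add, div_mul_eq_mul_div, div_le_iff₀ (by positivity)]
    nlinarith
  have hIpos : 0 < ∫ x in ball (0:E) R, β (‖x‖^2) := by
    refine (setIntegral_pos_iff_support_of_nonneg_ae (f := fun x : E => β (‖x‖^2))
      (Filter.Eventually.of_forall fun x => le_max_left _ _) (hci β hβ)).2 ?_
    refine IsOpen.measure_pos _ (IsOpen.inter ?_ isOpen_ball) ⟨0, ?_, by simpa using hR0⟩
    · exact Continuous.isOpen_support (by fun_prop)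
    · simp [β, hδ0]
  linarith

end

lemma exists_fixed_bounded {E : Type*} [NormedAddCommGroup E] [InnerProductSpace ℝ E]
    [FiniteDimensional ℝ E] (b : E → E) (hb : Continuous b) (C : ℝ) (hC : ∀ x, ‖b x‖ ≤ C) :
    ∃ x, b x = x := by
  let : MeasurableSpace E := borel E
  have : BorelSpace E := ⟨rfl⟩
  have hC0 : 0 ≤ C := (norm_nonneg _).trans (hC 0)
  let χ : E → ℝ := fun x => max 0 (min 1 (C + 2 - ‖x‖))
  have hχ : Continuous χ := by fun_prop
  let f : E → E := fun x => χ x • b x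
  have hf : Continuous f := by fun_prop
  have happ : ∀ ε > 0, ε < 1 → ∃ x ∈ closedBall (0:E) (C+2), ‖f x - x‖ ≤ ε := by
    intro ε hε _
    obtain ⟨g, hg, hgd, hgs⟩ := hf.exists_contDiff_approx 1 (ε := fun _ => ε)
      continuous_const (fun _ => hε)
    obtain ⟨x, hx, hxe⟩ := exists_fixed_smooth g (by exact_mod_cast hg) (C + 2) (by linarith) (by
      intro x hx
      by_contra h
      have h2 := hgs h
      apply h2
      have : χ x = 0 := max_eq_left ((min_le_right _ _).trans (by linarith))
      simp [f, this])
    refine ⟨x, hx, ?_⟩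
    have := hgd x
    rw [hxe, dist_comm, dist_eq_norm] at this
    exact this.le
  obtain ⟨x, hx, hmin⟩ := (isCompact_closedBall (0:E) (C+2)).exists_isMinOn
    ⟨0, by simp; linarith⟩ (f := fun x => ‖f x - x‖) (by fun_prop)
  have hfx : f x = x := by
    by_contra h
    have hp : 0 < ‖f x - x‖ := norm_pos_iff.2 (sub_ne_zero.2 h)
    obtain ⟨y, hy, hye⟩ := happ (min (‖f x - x‖ / 2) (1/2)) (by positivity)
      ((min_le_right _ _).trans_lt (by norm_num))
    have h1 : ‖f x - x‖ ≤ ‖f y - y‖ := hmin hy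
    have := min_le_left (‖f x - x‖ / 2) (1/2)
    linarith
  have hχ1 : |χ x| ≤ 1 := by
    rw [abs_of_nonneg (le_max_left _ _)]
    exact max_le zero_le_one (min_le_left _ _)
  have hxC : ‖x‖ ≤ C := by
    rw [← hfx]
    simp only [f]
    rw [norm_smul, Real.norm_eq_abs]
    nlinarith [hC x, norm_nonneg (b x)]
  have : χ x = 1 := by
    simp only [χ]
    rw [min_eq_left (by linarith)]
    simp
  refine ⟨x, ?_⟩
  simpa [f, this] using hfx

lemma exists_fixed_normed {V : Type*} [NormedAddCommGroup V] [NormedSpace ℝ V]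
    [FiniteDimensional ℝ V] (b : V → V) (hb : Continuous b) (C : ℝ) (hC : ∀ x, ‖b x‖ ≤ C) :
    ∃ x, b x = x := by
  let e : V ≃L[ℝ] EuclideanSpace ℝ (Fin (Module.finrank ℝ V)) := toEuclidean
  obtain ⟨x, hx⟩ := exists_fixed_bounded (fun y => e (b (e.symm y)))
    (by fun_prop) (‖(e : V →L[ℝ] EuclideanSpace ℝ (Fin (Module.finrank ℝ V)))‖ * C) (by
      intro y
      refine ((e : V →L[ℝ] EuclideanSpace ℝ (Fin (Module.finrank ℝ V))).le_opNorm _).trans ?_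
      gcongr
      exact hC _)
  refine ⟨e.symm x, ?_⟩
  apply e.injective
  simpa using hx

lemma exists_proj {F : Type*} [NormedAddCommGroup F] [InnerProductSpace ℝ F]
    (K : Set F) (hc : IsCompact K) (hconv : Convex ℝ K) (hne : K.Nonempty) :
    ∃ P : F → F, Continuous P ∧ (∀ x, P x ∈ K) ∧ ∀ x, ∀ w ∈ K, ⟪x - P x, w - P x⟫ ≤ 0 := by
  have h : ∀ x, ∃ v ∈ K, ∀ w ∈ K, ⟪x - v, w - v⟫ ≤ 0 := by
    intro x
    obtain ⟨v, hv, hvx⟩ := exists_norm_eq_iInf_of_complete_convex hne hc.isComplete hconv x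
    exact ⟨v, hv, (norm_eq_iInf_iff_real_inner_le_zero hconv hv).1 hvx⟩
  choose P hP hP2 using h
  refine ⟨P, ?_, hP, hP2⟩
  refine LipschitzWith.continuous (K := 1) (LipschitzWith.of_dist_le_mul fun x y => ?_)
  rw [NNReal.coe_one, one_mul, dist_eq_norm, dist_eq_norm]
  have h1 := hP2 x (P y) (hP y)
  have h2 := hP2 y (P x) (hP x)
  have h3 : ⟪P x - P y, P x - P y⟫ ≤ ⟪x - y, P x - P y⟫ := by
    simp only [inner_sub_left, inner_sub_right] at h1 h2 ⊢
    linarith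
  rw [real_inner_self_eq_norm_sq] at h3
  have h4 := real_inner_le_norm (x - y) (P x - P y)
  by_contra! h
  nlinarith [norm_nonneg (x - y), norm_nonneg (P x - P y)]

lemma continuous_gradient_fst {A B : Type*} [NormedAddCommGroup A] [InnerProductSpace ℝ A]
    [CompleteSpace A] [NormedAddCommGroup B] [NormedSpace ℝ B] (f : A → B → ℝ)
    (hf : ContDiff ℝ 1 (fun p : A × B => f p.1 p.2)) :
    Continuous (fun p : A × B => gradient (fun a => f a p.2) p.1) := by
  have h : ∀ p : A × B, gradient (fun a => f a p.2) p.1 = (InnerProductSpace.toDual ℝ A).symm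
      ((fderiv ℝ (fun p : A × B => f p.1 p.2) p).comp (ContinuousLinearMap.inl ℝ A B)) := by
    intro p
    rw [gradient]
    congr 1
    apply HasFDerivAt.fderiv
    have h1 := hasFDerivAt_prodMk_left (𝕜 := ℝ) p.1 p.2
    exact HasFDerivAt.comp (g := fun p : A × B => f p.1 p.2) p.1
      ((hf.differentiable one_ne_zero) (p.1, p.2)).hasFDerivAt h1
  simp only [h]
  have := hf.continuous_fderiv one_ne_zero
  fun_prop

lemma continuous_gradient_update {A B : Type*} {k : ℕ} [NormedAddCommGroup A] [NormedSpace ℝ A]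
    [NormedAddCommGroup B] [InnerProductSpace ℝ B] [CompleteSpace B] (i : Fin k)
    (f : A → (Fin k → B) → ℝ)
    (hf : ContDiff ℝ 1 (fun p : A × (Fin k → B) => f p.1 p.2)) :
    Continuous (fun p : A × (Fin k → B) =>
      gradient (fun ψ => f p.1 (Function.update p.2 i ψ)) (p.2 i)) := by
  have h : ∀ p : A × (Fin k → B), gradient (fun ψ => f p.1 (Function.update p.2 i ψ)) (p.2 i) =
      (InnerProductSpace.toDual ℝ B).symm
      ((fderiv ℝ (fun p : A × (Fin k → B) => f p.1 p.2) p).comp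
        ((ContinuousLinearMap.inr ℝ A (Fin k → B)).comp
          (ContinuousLinearMap.pi (Pi.single i (ContinuousLinearMap.id ℝ B))))) := by
    intro p
    rw [gradient]
    congr 1
    apply HasFDerivAt.fderiv
    have h0 := ((hf.differentiable one_ne_zero) p).hasFDerivAt
    have e : p = (p.1, Function.update p.2 i (p.2 i)) := by simp
    have h1 := (hasFDerivAt_prodMk_right (𝕜 := ℝ) p.1 (Function.update p.2 i (p.2 i))).comp
      (p.2 i) (hasFDerivAt_update (𝕜 := ℝ) (E := fun _ : Fin k => B) p.2 (i := i) (p.2 i))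
    refine HasFDerivAt.comp (g := fun p : A × (Fin k → B) => f p.1 p.2) (p.2 i) ?_ h1
    simpa using h0
  simp only [h]
  have := hf.continuous_fderiv one_ne_zero
  fun_prop

end FOSE

/-- Existence of a first-order Stackelberg/Nash equilibrium point on compact
convex strategy sets. -/
theorem exists_meta_FOSE {m n k : ℕ}
    (Θ : Set (EuclideanSpace ℝ (Fin m))) (Φ : Set (EuclideanSpace ℝ (Fin n)))
    (hΘc : IsCompact Θ) (hΘconv : Convex ℝ Θ) (hΘne : Θ.Nonempty)
    (hΦc : IsCompact Φ) (hΦconv : Convex ℝ Φ) (hΦne : Φ.Nonempty)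
    (ℓD : EuclideanSpace ℝ (Fin m) → (Fin k → EuclideanSpace ℝ (Fin n)) → ℝ)
    (ℓ : Fin k → EuclideanSpace ℝ (Fin m) → (Fin k → EuclideanSpace ℝ (Fin n)) → ℝ)
    (hℓD : ContDiff ℝ 1 (fun p : EuclideanSpace ℝ (Fin m) × (Fin k → EuclideanSpace ℝ (Fin n)) => ℓD p.1 p.2))
    (hℓ : ∀ i, ContDiff ℝ 1 (fun p : EuclideanSpace ℝ (Fin m) × (Fin k → EuclideanSpace ℝ (Fin n)) => ℓ i p.1 p.2)) :
    ∃ θstar ∈ Θ, ∃ φstar : Fin k → EuclideanSpace ℝ (Fin n), (∀ i, φstar i ∈ Φ) ∧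
      (∀ θ ∈ Θ, ⟪gradient (fun θ' => ℓD θ' φstar) θstar, θ - θstar⟫ ≤ 0) ∧
      (∀ i, ∀ φi ∈ Φ,
        ⟪gradient (fun ψ => ℓ i θstar (Function.update φstar i ψ)) (φstar i), φi - φstar i⟫ ≤ 0) := by
  obtain ⟨P, hPc, hPm, hPi⟩ := FOSE.exists_proj Θ hΘc hΘconv hΘne
  obtain ⟨Q, hQc, hQm, hQi⟩ := FOSE.exists_proj Φ hΦc hΦconv hΦne
  let G : (EuclideanSpace ℝ (Fin m) × (Fin k → EuclideanSpace ℝ (Fin n))) →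
      (EuclideanSpace ℝ (Fin m) × (Fin k → EuclideanSpace ℝ (Fin n))) := fun p => (p.1 + gradient (fun θ' => ℓD θ' p.2) p.1, fun i =>
    p.2 i + gradient (fun ψ => ℓ i p.1 (Function.update p.2 i ψ)) (p.2 i))
  have hG : Continuous G := by
    refine Continuous.prodMk (continuous_fst.add (FOSE.continuous_gradient_fst ℓD hℓD)) ?_
    refine continuous_pi fun i => ?_
    exact ((continuous_apply i).comp continuous_snd).add
      (FOSE.continuous_gradient_update i (ℓ i) (hℓ i))
  let Pr : (EuclideanSpace ℝ (Fin m) × (Fin k → EuclideanSpace ℝ (Fin n))) →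
      (EuclideanSpace ℝ (Fin m) × (Fin k → EuclideanSpace ℝ (Fin n))) := fun p => (P p.1, fun i => Q (p.2 i))
  have hPr : Continuous Pr := by fun_prop
  have hK : IsCompact (Θ ×ˢ (Set.univ.pi fun _ : Fin k => Φ)) :=
    hΘc.prod (isCompact_univ_pi fun _ => hΦc)
  obtain ⟨C, hC⟩ := hK.exists_bound_of_continuousOn (f := G) hG.continuousOn
  obtain ⟨x, hx⟩ := FOSE.exists_fixed_normed (fun p => G (Pr p)) (hG.comp hPr) C
    (fun p => hC _ ⟨hPm _, fun i _ => hQm _⟩)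
  have hx1 : P x.1 + gradient (fun θ' => ℓD θ' (fun i => Q (x.2 i))) (P x.1) = x.1 :=
    congrArg (fun p : (EuclideanSpace ℝ (Fin m) × (Fin k → EuclideanSpace ℝ (Fin n))) => p.1) hx
  have hx2 : ∀ i, Q (x.2 i) + gradient (fun ψ => ℓ i (P x.1)
      (Function.update (fun i => Q (x.2 i)) i ψ)) (Q (x.2 i)) = x.2 i :=
    fun i => congrFun (congrArg (fun p : (EuclideanSpace ℝ (Fin m) × (Fin k → EuclideanSpace ℝ (Fin n))) => p.2) hx) i
  refine ⟨P x.1, hPm _, fun i => Q (x.2 i), fun i => hQm _, ?_, ?_⟩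
  · intro θ hθ
    rw [eq_sub_of_add_eq' hx1]
    exact hPi _ _ hθ
  · intro i φi hφ
    rw [eq_sub_of_add_eq' (hx2 i)]
    exact hQi _ _ hφ
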